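/- arXiv:1808.06558 — 7 statements merged into one kernel-verified Lean document; each statement's English description precedes it below -/
import Mathlib

section
/- Let N ≥ 1, let T : (Fin N → Fin 3) → ℝ be a correlation tensor, let t be a positive integer, and let v₁,…,v_L ∈ S² be a spherical t-design. Then the t-th moment can be evaluated by the finite design average: R^(t)(T) = (1/L^N) Σ_{k₁=1}^{L} ⋯ Σ_{k_N=1}^{L} E_T(v_{k₁},…,v_{k_N})^t. -/
open MeasureTheory

noncomputable section

abbrev E3 : Type := EuclideanSpace ℝ (Fin 3)

/-- The unit sphere `S²` in `ℝ³`. -/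
abbrev S2 : Type := Metric.sphere (0 : E3) 1

/-- The action of a linear isometry (rotation) of `ℝ³` on the unit sphere. -/
def sphereMap (f : E3 ≃ₗᵢ[ℝ] E3) (x : S2) : S2 :=
  ⟨f x, by
    have h : ‖(x : E3)‖ = 1 := by simpa using mem_sphere_zero_iff_norm.mp x.2
    simp [mem_sphere_zero_iff_norm, h]⟩

/-- The multilinear correlation function `E_T(u₁,…,u_N)` associated with a correlation
tensor `T : (Fin N → Fin 3) → ℝ`. -/
def corrFun (N : ℕ) (T : (Fin N → Fin 3) → ℝ) (u : Fin N → S2) : ℝ :=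
  ∑ i : Fin N → Fin 3, T i * ∏ n, (u n : E3) (i n)

/-- Expansion of a power of the correlation function into products of one-site monomials. -/
lemma corrFun_pow (N : ℕ) (T : (Fin N → Fin 3) → ℝ) (t : ℕ) (u : Fin N → S2) :
    corrFun N T u ^ t =
      ∑ p : Fin t → Fin N → Fin 3, (∏ s, T (p s)) * ∏ n, ∏ s, (u n : E3) (p s n) := by
  rw [corrFun, Fintype.sum_pow]
  refine Finset.sum_congr rfl fun p _ => ?_
  rw [Finset.prod_mul_distrib, Finset.prod_comm]

/-- A continuous real function on a compact space is integrable for a finite measure. -/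
lemma integrable_of_continuous {X : Type*} [TopologicalSpace X] [CompactSpace X]
    [MeasurableSpace X] [OpensMeasurableSpace X] (ν : Measure X) [IsFiniteMeasure ν]
    {g : X → ℝ} (hg : Continuous g) : Integrable g ν :=
  hg.integrable_of_hasCompactSupport (HasCompactSupport.of_compactSpace g)

/-- A spherical `t`-design integrates products of `t` coordinate functions exactly. -/
lemma design_average_prod_coord (μ : Measure S2) (t L : ℕ) (v : Fin L → S2)
    (hdesign : ∀ P : MvPolynomial (Fin 3) ℝ, P.totalDegree ≤ t →
      (1 / (L : ℝ)) * ∑ k, MvPolynomial.eval (fun j => (v k : E3) j) P =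
        ∫ x : S2, MvPolynomial.eval (fun j => (x : E3) j) P ∂μ) (q : Fin t → Fin 3) :
    ∫ x : S2, ∏ s, (x : E3) (q s) ∂μ = (1 / (L : ℝ)) * ∑ k, ∏ s, (v k : E3) (q s) := by
  have hdeg : (∏ s, (MvPolynomial.X (q s) : MvPolynomial (Fin 3) ℝ)).totalDegree ≤ t :=
    (MvPolynomial.totalDegree_finsetProd _ _).trans (by simp)
  simpa [MvPolynomial.eval_prod] using (hdesign _ hdeg).symm

/-- if `v₁,…,v_L ∈ S²` is a spherical `t`-design, then the `t`-th moment of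
the random correlation function can be evaluated by the finite design average:
`R^(t)(T) = (1/L^N) Σ_{k₁,…,k_N} E_T(v_{k₁},…,v_{k_N})^t`. -/
theorem moment_eq_design_average (N : ℕ) (hN : 1 ≤ N) (T : (Fin N → Fin 3) → ℝ)
    (μ : Measure S2) [IsProbabilityMeasure μ]
    (hinv : ∀ f : E3 ≃ₗᵢ[ℝ] E3, μ.map (sphereMap f) = μ)
    (t : ℕ) (ht : 0 < t)
    (L : ℕ) (hL : 0 < L) (v : Fin L → S2)
    (hdesign : ∀ P : MvPolynomial (Fin 3) ℝ, P.totalDegree ≤ t →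
      (1 / (L : ℝ)) * ∑ k, MvPolynomial.eval (fun j => (v k : E3) j) P =
        ∫ x : S2, MvPolynomial.eval (fun j => (x : E3) j) P ∂μ) :
    ∫ u : Fin N → S2, corrFun N T u ^ t ∂(Measure.pi fun _ => μ) =
      (1 / (L : ℝ) ^ N) * ∑ k : Fin N → Fin L, corrFun N T (fun n => v (k n)) ^ t := by
  simp_rw [corrFun_pow]
  rw [integral_finsetSum _ fun p _ => integrable_of_continuous _ (by fun_prop),
    Finset.sum_comm, Finset.mul_sum]
  refine Finset.sum_congr rfl fun p _ => ?_
  rw [integral_const_mul, ← Finset.mul_sum,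
    integral_fintype_prod_eq_prod (fun n (x : S2) => ∏ s, (x : E3) (p s n)),
    ← Fintype.prod_sum (fun n k => ∏ s, (v k : E3) (p s n))]
  simp_rw [fun n => design_average_prod_coord μ t L v hdesign (fun s => p s n)]
  rw [Finset.prod_mul_distrib, Finset.prod_const, Finset.card_fin]
  ring
end
end

section
/- Let φ = (1+√5)/2 be the golden ratio. The twelve vertices of the regular icosahedron, namely the points (0, ±1, ±φ)/√(1+φ²), (±1, ±φ, 0)/√(1+φ²), (±φ, 0, ±1)/√(1+φ²), form a spherical 5-design on S²: for every real polynomial P in three variables of total degree at most 5, (1/12) Σ over these twelve points of P equals ∫_{S²} P dμ. -/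
open MeasureTheory

noncomputable section

/-- The golden ratio `φ = (1+√5)/2`. -/
def goldenRatio' : ℝ := (1 + Real.sqrt 5) / 2

/-- The twelve vertices of the regular icosahedron on the unit sphere:
the cyclic shifts (indexed by `c : Fin 3`) of `(0, ±1, ±φ)/√(1+φ²)`, i.e. the points
`(0, ±1, ±φ)/√(1+φ²)`, `(±φ, 0, ±1)/√(1+φ²)` and `(±1, ±φ, 0)/√(1+φ²)`, with the two
signs indexed by `s₁ s₂ : Fin 2` (value `0` giving `+`, value `1` giving `-`). -/
def icoVec (c : Fin 3) (s₁ s₂ : Fin 2) : E3 :=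
  (WithLp.equiv 2 (Fin 3 → ℝ)).symm (fun j =>
    (if j - c = 1 then (if s₁ = 0 then (1 : ℝ) else -1)
      else if j - c = 2 then (if s₂ = 0 then (1 : ℝ) else -1) * goldenRatio'
      else 0) / Real.sqrt (1 + goldenRatio' ^ 2))

open Submodule

/-- The moment `∫ x₀ᵃ x₁ᵇ x₂ᶜ dμ` of a measure on the sphere. -/
def sphereMoment (μ : Measure S2) (a b c : ℕ) : ℝ :=
  ∫ x : S2, (x : E3) 0 ^ a * (x : E3) 1 ^ b * (x : E3) 2 ^ c ∂μ

/-- The measure `μ` on the sphere is invariant under all linear isometries of `ℝ³`. -/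
def IsometryInvariant (μ : Measure S2) : Prop :=
  ∀ f : E3 ≃ₗᵢ[ℝ] E3, μ.map (sphereMap f) = μ

lemma continuous_sphereMap (f : E3 ≃ₗᵢ[ℝ] E3) : Continuous (sphereMap f) :=
  Continuous.subtype_mk (f.continuous.comp continuous_subtype_val) _

lemma Continuous.integrable_sphere {μ : Measure S2} [IsFiniteMeasure μ] {g : S2 → ℝ}
    (hg : Continuous g) : Integrable g μ :=
  hg.integrable_of_hasCompactSupport (HasCompactSupport.of_compactSpace g)

lemma IsometryInvariant.integral_comp {μ : Measure S2} (hμ : IsometryInvariant μ)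
    (f : E3 ≃ₗᵢ[ℝ] E3) {g : S2 → ℝ} (hg : Continuous g) :
    ∫ x, g (sphereMap f x) ∂μ = ∫ x, g x ∂μ := by
  conv_rhs => rw [← hμ f]
  exact (integral_map (continuous_sphereMap f).aemeasurable hg.aestronglyMeasurable).symm

lemma reflection_orthogonal_span_apply (u x : E3) (i : Fin 3) :
    (ℝ ∙ u)ᗮ.reflection x i =
      x i - 2 * ((u 0 * x 0 + u 1 * x 1 + u 2 * x 2) / (u 0 ^ 2 + u 1 ^ 2 + u 2 ^ 2)) * u i := by
  rw [reflection_orthogonal_apply, reflection_singleton_apply]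
  simp [EuclideanSpace.real_norm_sq_eq, PiLp.inner_apply, Fin.sum_univ_three]
  ring

/-- The moments of an invariant measure can be computed after reflecting along any vector `u`. -/
lemma IsometryInvariant.moment_reflection {μ : Measure S2} (hμ : IsometryInvariant μ)
    (u : E3) (a b c : ℕ) :
    sphereMoment μ a b c =
      ∫ x : S2, ((ℝ ∙ u)ᗮ.reflection (x : E3)) 0 ^ a * ((ℝ ∙ u)ᗮ.reflection (x : E3)) 1 ^ b *
        ((ℝ ∙ u)ᗮ.reflection (x : E3)) 2 ^ c ∂μ :=
  (hμ.integral_comp (ℝ ∙ u)ᗮ.reflection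
    (g := fun x : S2 => (x : E3) 0 ^ a * (x : E3) 1 ^ b * (x : E3) 2 ^ c) (by fun_prop)).symm

lemma IsometryInvariant.moment_swap_zero_one {μ : Measure S2} (hμ : IsometryInvariant μ)
    (a b c : ℕ) : sphereMoment μ a b c = sphereMoment μ b a c := by
  rw [hμ.moment_reflection !₂[1, -1, 0], sphereMoment]
  congr 1 with x
  simp only [reflection_orthogonal_span_apply]
  simp
  left
  ring_nf

lemma IsometryInvariant.moment_swap_one_two {μ : Measure S2} (hμ : IsometryInvariant μ)
    (a b c : ℕ) : sphereMoment μ a b c = sphereMoment μ a c b := by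
  rw [hμ.moment_reflection !₂[0, 1, -1], sphereMoment]
  congr 1 with x
  simp only [reflection_orthogonal_span_apply]
  simp
  ring_nf

lemma IsometryInvariant.moment_odd {μ : Measure S2} (hμ : IsometryInvariant μ)
    {a : ℕ} (ha : Odd a) (b c : ℕ) : sphereMoment μ a b c = 0 := by
  have h := hμ.moment_reflection !₂[1, 0, 0] a b c
  have hneg : ∀ x : ℝ, (x - 2 * x) ^ a = -x ^ a := fun x => by
    rw [← ha.neg_pow]; ring
  simp only [reflection_orthogonal_span_apply] at h
  simp [hneg, integral_neg] at h
  rw [← sphereMoment] at h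
  linarith

lemma IsometryInvariant.moment_eq_zero_of_odd {μ : Measure S2} (hμ : IsometryInvariant μ)
    {a b c : ℕ} (h : Odd a ∨ Odd b ∨ Odd c) : sphereMoment μ a b c = 0 := by
  rcases h with h | h | h
  · exact hμ.moment_odd h b c
  · rw [hμ.moment_swap_zero_one, hμ.moment_odd h]
  · rw [hμ.moment_swap_one_two, hμ.moment_swap_zero_one, hμ.moment_odd h]

lemma sphere_sum_sq (x : S2) : (x : E3) 0 ^ 2 + (x : E3) 1 ^ 2 + (x : E3) 2 ^ 2 = 1 := by
  have h : ‖(x : E3)‖ = 1 := by simp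
  have h' := EuclideanSpace.real_norm_sq_eq (x : E3)
  rw [h, Fin.sum_univ_three] at h'
  linarith

lemma integrable_sphere_monomial (μ : Measure S2) [IsFiniteMeasure μ] (a b c : ℕ) :
    Integrable (fun x : S2 => (x : E3) 0 ^ a * (x : E3) 1 ^ b * (x : E3) 2 ^ c) μ :=
  Continuous.integrable_sphere (by fun_prop)

/-- Multiplying a monomial by `x₀² + x₁² + x₂² = 1` does not change its moment. -/
lemma sphereMoment_eq_add (μ : Measure S2) [IsFiniteMeasure μ] (a b c : ℕ) :
    sphereMoment μ a b c =
      sphereMoment μ (a + 2) b c + sphereMoment μ a (b + 2) c + sphereMoment μ a b (c + 2) := by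
  have hi := integrable_sphere_monomial μ
  simp only [sphereMoment]
  rw [← integral_add (hi _ _ _) (hi _ _ _),
    ← integral_add (Continuous.integrable_sphere (by fun_prop)) (hi _ _ _)]
  congr 1 with x
  linear_combination (-((x : E3) 0 ^ a * (x : E3) 1 ^ b * (x : E3) 2 ^ c)) * sphere_sum_sq x

lemma sphereMoment_zero (μ : Measure S2) [IsProbabilityMeasure μ] : sphereMoment μ 0 0 0 = 1 := by
  simp [sphereMoment]

lemma IsometryInvariant.moment_two {μ : Measure S2} [IsProbabilityMeasure μ]
    (hμ : IsometryInvariant μ) : sphereMoment μ 2 0 0 = 1 / 3 := by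
  have h := sphereMoment_eq_add μ 0 0 0
  rw [sphereMoment_zero, zero_add, hμ.moment_swap_one_two 0 0 2, hμ.moment_swap_zero_one 0 2 0] at h
  linarith

lemma IsometryInvariant.moment_four_eq {μ : Measure S2} [IsProbabilityMeasure μ]
    (hμ : IsometryInvariant μ) : sphereMoment μ 4 0 0 = 3 * sphereMoment μ 2 2 0 := by
  have h := hμ.moment_reflection !₂[1, -2, 0] 4 0 0
  have expand : ∀ x : S2, ((ℝ ∙ (!₂[1, -2, 0] : E3))ᗮ.reflection (x : E3)) 0 ^ 4 *
      ((ℝ ∙ (!₂[1, -2, 0] : E3))ᗮ.reflection (x : E3)) 1 ^ 0 *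
        ((ℝ ∙ (!₂[1, -2, 0] : E3))ᗮ.reflection (x : E3)) 2 ^ 0 =
      81 / 625 * ((x : E3) 0 ^ 4 * (x : E3) 1 ^ 0 * (x : E3) 2 ^ 0) +
      432 / 625 * ((x : E3) 0 ^ 3 * (x : E3) 1 ^ 1 * (x : E3) 2 ^ 0) +
      864 / 625 * ((x : E3) 0 ^ 2 * (x : E3) 1 ^ 2 * (x : E3) 2 ^ 0) +
      768 / 625 * ((x : E3) 0 ^ 1 * (x : E3) 1 ^ 3 * (x : E3) 2 ^ 0) +
      256 / 625 * ((x : E3) 0 ^ 0 * (x : E3) 1 ^ 4 * (x : E3) 2 ^ 0) := by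
    intro x
    simp only [reflection_orthogonal_span_apply]
    simp
    ring
  simp only [expand] at h
  iterate 4 rw [integral_add (Continuous.integrable_sphere (by fun_prop))
    (Continuous.integrable_sphere (by fun_prop))] at h
  simp only [integral_const_mul] at h
  iterate 5 rw [← sphereMoment] at h
  rw [hμ.moment_eq_zero_of_odd (a := 3) (by decide), hμ.moment_eq_zero_of_odd (a := 1) (by decide),
    hμ.moment_swap_zero_one 0 4 0] at h
  linarith

lemma IsometryInvariant.moment_two_two {μ : Measure S2} [IsProbabilityMeasure μ]
    (hμ : IsometryInvariant μ) : sphereMoment μ 2 2 0 = 1 / 15 := by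
  have h := sphereMoment_eq_add μ 2 0 0
  rw [hμ.moment_two, zero_add, hμ.moment_swap_one_two 2 0 2] at h
  linarith [hμ.moment_four_eq]

lemma IsometryInvariant.moment_four {μ : Measure S2} [IsProbabilityMeasure μ]
    (hμ : IsometryInvariant μ) : sphereMoment μ 4 0 0 = 1 / 5 := by
  rw [hμ.moment_four_eq, hμ.moment_two_two]
  norm_num

/-- The short coordinate `1/√(1+φ²)` of a vertex of the icosahedron. -/
def icoShort : ℝ := 1 / Real.sqrt (1 + goldenRatio' ^ 2)

/-- The long coordinate `φ/√(1+φ²)` of a vertex of the icosahedron. -/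
def icoLong : ℝ := goldenRatio' / Real.sqrt (1 + goldenRatio' ^ 2)

lemma icoShort_sq_add_icoLong_sq : icoShort ^ 2 + icoLong ^ 2 = 1 := by
  have h : 0 < 1 + goldenRatio' ^ 2 := by positivity
  rw [icoShort, icoLong, div_pow, div_pow, Real.sq_sqrt h.le]
  field_simp

lemma icoShort_sq_mul_icoLong_sq : icoShort ^ 2 * icoLong ^ 2 = 1 / 5 := by
  have h : 0 < 1 + goldenRatio' ^ 2 := by positivity
  have hφ : goldenRatio' ^ 2 = goldenRatio' + 1 := by
    rw [goldenRatio']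
    linear_combination (1 / 4) * Real.sq_sqrt (show (0 : ℝ) ≤ 5 by norm_num)
  rw [icoShort, icoLong, div_pow, div_pow, Real.sq_sqrt h.le]
  field_simp
  linear_combination (1 - goldenRatio' - goldenRatio' ^ 2) * hφ

lemma icoVec_zero (s₁ s₂ : Fin 2) :
    icoVec 0 s₁ s₂ =
      !₂[0, if s₁ = 0 then icoShort else -icoShort, if s₂ = 0 then icoLong else -icoLong] := by
  ext j
  fin_cases j <;> fin_cases s₁ <;> fin_cases s₂ <;>
    simp [icoVec, icoShort, icoLong, neg_div, show (2 : Fin 3) ≠ 1 by decide]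

lemma icoVec_one (s₁ s₂ : Fin 2) :
    icoVec 1 s₁ s₂ =
      !₂[if s₂ = 0 then icoLong else -icoLong, 0, if s₁ = 0 then icoShort else -icoShort] := by
  ext j
  fin_cases j <;> fin_cases s₁ <;> fin_cases s₂ <;>
    simp [icoVec, icoShort, icoLong, neg_div, show (2 : Fin 3) - 1 = 1 by decide,
      show (-1 : Fin 3) = 2 by decide, show (2 : Fin 3) ≠ 1 by decide]

lemma icoVec_two (s₁ s₂ : Fin 2) :
    icoVec 2 s₁ s₂ =
      !₂[if s₁ = 0 then icoShort else -icoShort, if s₂ = 0 then icoLong else -icoLong, 0] := by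
  ext j
  fin_cases j <;> fin_cases s₁ <;> fin_cases s₂ <;>
    simp [icoVec, icoShort, icoLong, neg_div, show (1 : Fin 3) - 2 = 2 by decide,
      show (-2 : Fin 3) = 1 by decide, show (2 : Fin 3) ≠ 1 by decide]

lemma icoVec_mem_sphere (k : Fin 3) (s₁ s₂ : Fin 2) :
    icoVec k s₁ s₂ ∈ Metric.sphere (0 : E3) 1 := by
  have h := icoShort_sq_add_icoLong_sq
  rw [mem_sphere_zero_iff_norm, ← sq_eq_sq₀ (norm_nonneg _) zero_le_one,
    EuclideanSpace.real_norm_sq_eq, Fin.sum_univ_three]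
  fin_cases k <;> fin_cases s₁ <;> fin_cases s₂ <;>
    simp [icoVec_zero, icoVec_one, icoVec_two] <;> linarith

/-- The sum of a monomial over the twelve vertices of the icosahedron. -/
lemma sum_icoVec_monomial (a b c : ℕ) :
    ∑ k : Fin 3, ∑ s₁ : Fin 2, ∑ s₂ : Fin 2,
      icoVec k s₁ s₂ 0 ^ a * icoVec k s₁ s₂ 1 ^ b * icoVec k s₁ s₂ 2 ^ c =
    0 ^ a * (icoShort ^ b + (-icoShort) ^ b) * (icoLong ^ c + (-icoLong) ^ c) +
    0 ^ b * (icoShort ^ c + (-icoShort) ^ c) * (icoLong ^ a + (-icoLong) ^ a) +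
    0 ^ c * (icoShort ^ a + (-icoShort) ^ a) * (icoLong ^ b + (-icoLong) ^ b) := by
  simp [Fin.sum_univ_three, Fin.sum_univ_two, icoVec_zero, icoVec_one, icoVec_two]
  ring

lemma sum_icoVec_monomial_of_odd {a b c : ℕ} (h : Odd a ∨ Odd b ∨ Odd c) :
    ∑ k : Fin 3, ∑ s₁ : Fin 2, ∑ s₂ : Fin 2,
      icoVec k s₁ s₂ 0 ^ a * icoVec k s₁ s₂ 1 ^ b * icoVec k s₁ s₂ 2 ^ c = 0 := by
  rw [sum_icoVec_monomial]
  rcases h with h | h | h <;> simp [h.neg_pow, h.pos.ne']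

/-- The icosahedron integrates every monomial of degree at most five exactly. -/
lemma IsometryInvariant.icosahedron_monomial {μ : Measure S2} [IsProbabilityMeasure μ]
    (hμ : IsometryInvariant μ) {a b c : ℕ} (h : a + b + c ≤ 5) :
    (1 / 12 : ℝ) * ∑ k : Fin 3, ∑ s₁ : Fin 2, ∑ s₂ : Fin 2,
      icoVec k s₁ s₂ 0 ^ a * icoVec k s₁ s₂ 1 ^ b * icoVec k s₁ s₂ 2 ^ c =
    sphereMoment μ a b c := by
  by_cases hodd : Odd a ∨ Odd b ∨ Odd c
  · rw [sum_icoVec_monomial_of_odd hodd, hμ.moment_eq_zero_of_odd hodd, mul_zero]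
  have h₁ := icoShort_sq_add_icoLong_sq
  have h₂ := icoShort_sq_mul_icoLong_sq
  have h₄ : icoShort ^ 4 + icoLong ^ 4 = 3 / 5 := by
    linear_combination (icoShort ^ 2 + icoLong ^ 2 + 1) * h₁ - 2 * h₂
  simp only [not_or, Nat.not_odd_iff_even] at hodd
  obtain ⟨⟨a, rfl⟩, ⟨b, rfl⟩, ⟨c, rfl⟩⟩ := hodd
  rw [sum_icoVec_monomial]
  have m₁ := hμ.moment_swap_zero_one
  have m₂ := hμ.moment_swap_one_two
  have hcases : (a, b, c) ∈ ({(0, 0, 0), (1, 0, 0), (0, 1, 0), (0, 0, 1), (2, 0, 0), (0, 2, 0),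
      (0, 0, 2), (1, 1, 0), (1, 0, 1), (0, 1, 1)} : Finset (ℕ × ℕ × ℕ)) := by
    have : a ≤ 2 := by omega
    have : b ≤ 2 := by omega
    have : c ≤ 2 := by omega
    interval_cases a <;> interval_cases b <;> interval_cases c <;> first | decide | omega
  simp only [Finset.mem_insert, Finset.mem_singleton, Prod.mk.injEq] at hcases
  rcases hcases with ⟨rfl, rfl, rfl⟩ | ⟨rfl, rfl, rfl⟩ | ⟨rfl, rfl, rfl⟩ | ⟨rfl, rfl, rfl⟩ |
    ⟨rfl, rfl, rfl⟩ | ⟨rfl, rfl, rfl⟩ | ⟨rfl, rfl, rfl⟩ | ⟨rfl, rfl, rfl⟩ | ⟨rfl, rfl, rfl⟩ |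
    ⟨rfl, rfl, rfl⟩ <;> norm_num
  · rw [sphereMoment_zero]
  · rw [hμ.moment_two]; linarith
  · rw [m₁, hμ.moment_two]; linarith
  · rw [m₂, m₁, hμ.moment_two]; linarith
  · rw [hμ.moment_four]; linarith
  · rw [m₁, hμ.moment_four]; linarith
  · rw [m₂, m₁, hμ.moment_four]; linarith
  · rw [hμ.moment_two_two]; linarith
  · rw [m₂, hμ.moment_two_two]; linarith
  · rw [m₁, m₂, hμ.moment_two_two]; linarith

/-- the twelve vertices of the regular icosahedron, namely
`(0, ±1, ±φ)/√(1+φ²)`, `(±1, ±φ, 0)/√(1+φ²)`, `(±φ, 0, ±1)/√(1+φ²)` with `φ = (1+√5)/2`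
the golden ratio, form a spherical `5`-design on `S²`: they lie on the unit sphere, and for
every real polynomial `P` in three variables of total degree at most `5`, the average of `P`
over the twelve points equals `∫_{S²} P dμ`, where `μ` is the rotation-invariant (uniform)
probability measure on `S²`. -/
theorem icosahedron_is_five_design
    (μ : Measure S2) [IsProbabilityMeasure μ]
    (hinv : ∀ f : E3 ≃ₗᵢ[ℝ] E3, μ.map (sphereMap f) = μ) :
    (∀ (c : Fin 3) (s₁ s₂ : Fin 2), icoVec c s₁ s₂ ∈ Metric.sphere (0 : E3) 1) ∧
    (∀ P : MvPolynomial (Fin 3) ℝ, P.totalDegree ≤ 5 →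
      (1 / 12 : ℝ) * ∑ c : Fin 3, ∑ s₁ : Fin 2, ∑ s₂ : Fin 2,
          MvPolynomial.eval (fun j => icoVec c s₁ s₂ j) P =
        ∫ x : S2, MvPolynomial.eval (fun j => (x : E3) j) P ∂μ) := by
  refine ⟨icoVec_mem_sphere, fun P hP => ?_⟩
  have hμ : IsometryInvariant μ := hinv
  simp only [MvPolynomial.eval_eq', Fin.prod_univ_three]
  rw [integral_finsetSum _ fun d _ => (integrable_sphere_monomial μ _ _ _).const_mul _]
  simp only [Finset.sum_comm (t := P.support), ← Finset.mul_sum, integral_const_mul]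
  rw [Finset.mul_sum]
  refine Finset.sum_congr rfl fun d hd => ?_
  have hdeg : d 0 + d 1 + d 2 ≤ 5 := by
    have := (MvPolynomial.le_totalDegree hd).trans hP
    rwa [Finsupp.sum_fintype _ _ (fun _ => rfl), Fin.sum_univ_three] at this
  rw [← sphereMoment, ← hμ.icosahedron_monomial hdeg]
  ring
end
end

section
/- Let ρ be a separable two-qubit density matrix. Then its fourth moment of random correlations satisfies R^(4)(ρ) := ∬_{S²×S²} (Tr[ρ (σ_u ⊗ σ_w)])⁴ dμ(u) dμ(w) ≤ 1/25. -/
open MeasureTheory Matrix Kronecker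
open scoped ComplexOrder

noncomputable section

/-- The three Pauli matrices `σ_x, σ_y, σ_z`. -/
def pauli : Fin 3 → Matrix (Fin 2) (Fin 2) ℂ
  | 0 => !![0, 1; 1, 0]
  | 1 => !![0, -Complex.I; Complex.I, 0]
  | 2 => !![1, 0; 0, -1]

/-- For a direction `u ∈ ℝ³`, the operator `σ_u = u₁σ₁ + u₂σ₂ + u₃σ₃`. -/
def pauliVec (u : Fin 3 → ℝ) : Matrix (Fin 2) (Fin 2) ℂ :=
  ∑ j, (u j : ℂ) • pauli j

/-- The coordinates of a point of the unit sphere `S²`. -/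
def coords (x : S2) : Fin 3 → ℝ := fun j => (x : E3) j

/-- A two-qubit density matrix `ρ` is separable if it is a finite convex combination of
Kronecker products of single-qubit density matrices. -/
def IsSeparableTwoQubit (ρ : Matrix (Fin 2 × Fin 2) (Fin 2 × Fin 2) ℂ) : Prop :=
  ∃ (n : ℕ) (p : Fin n → ℝ) (A B : Fin n → Matrix (Fin 2) (Fin 2) ℂ),
    (∀ k, 0 ≤ p k) ∧ (∑ k, p k = 1) ∧
    (∀ k, (A k).PosSemidef) ∧ (∀ k, (A k).trace = 1) ∧
    (∀ k, (B k).PosSemidef) ∧ (∀ k, (B k).trace = 1) ∧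
    ρ = ∑ k, (p k : ℂ) • (A k ⊗ₖ B k)

/-- A single-qubit density matrix has a Bloch vector in the closed unit ball. -/
lemma exists_bloch_vector {A : Matrix (Fin 2) (Fin 2) ℂ} (hA : A.PosSemidef)
    (htr : A.trace = 1) :
    ∃ a : E3, ‖a‖ ≤ 1 ∧ ∀ x : S2,
      (A * pauliVec (coords x)).trace = ((inner ℝ a (x : E3) : ℝ) : ℂ) := by
  have h00 := hA.isHermitian.apply 0 0
  have h11 := hA.isHermitian.apply 1 1
  have h01 := hA.isHermitian.apply 0 1
  have hdet := hA.det_nonneg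
  rw [Matrix.trace_fin_two] at htr
  rw [Matrix.det_fin_two] at hdet
  simp only [Complex.ext_iff, Complex.le_def, Complex.star_def, Complex.conj_re, Complex.conj_im,
    Complex.add_re, Complex.add_im, Complex.one_re, Complex.one_im, Complex.sub_re,
    Complex.sub_im, Complex.mul_re, Complex.mul_im, Complex.zero_re, Complex.zero_im]
    at h00 h11 h01 htr hdet
  obtain ⟨-, h00⟩ := h00
  obtain ⟨-, h11⟩ := h11
  obtain ⟨hre, him⟩ := h01
  have h00' : (A 0 0).im = 0 := by linarith
  have h11' : (A 1 1).im = 0 := by linarith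
  refine ⟨!₂[2 * (A 0 1).re, -2 * (A 0 1).im, (A 0 0).re - (A 1 1).re], ?_, fun x => ?_⟩
  · rw [← sq_le_one_iff₀ (norm_nonneg _), EuclideanSpace.real_norm_sq_eq, Fin.sum_univ_three]
    simp only [Matrix.cons_val]
    have h := hdet.1
    rw [h00', h11', ← hre, ← him] at *
    have h1 : (A 1 1).re = 1 - (A 0 0).re := by linarith [htr.1]
    rw [h1] at h ⊢
    nlinarith
  · simp only [pauliVec, coords, Fin.sum_univ_three, pauli, Matrix.trace_fin_two,
      Matrix.mul_apply, Fin.sum_univ_two, PiLp.inner_apply, RCLike.inner_apply, conj_trivial,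
      Complex.ext_iff]
    constructor
    · simp [← hre, ← him]
      ring
    · simp [← hre, ← him, h00', h11']
      ring

/-- The fourth moment of the projection of a random point of the sphere onto `v`. -/
def fourthMoment (μ : Measure S2) (v : E3) : ℝ :=
  ∫ x : S2, (inner ℝ v (x : E3) : ℝ) ^ 4 ∂μ

lemma continuous_inner_pow (v : E3) :
    Continuous fun x : S2 => (inner ℝ v (x : E3) : ℝ) ^ 4 := by
  fun_prop

lemma integrable_inner_pow (μ : Measure S2) [IsProbabilityMeasure μ] (v : E3) :
    Integrable (fun x : S2 => (inner ℝ v (x : E3) : ℝ) ^ 4) μ :=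
  (continuous_inner_pow v).integrable_of_hasCompactSupport (HasCompactSupport.of_compactSpace _)

lemma fourthMoment_smul (μ : Measure S2) (c : ℝ) (v : E3) :
    fourthMoment μ (c • v) = c ^ 4 * fourthMoment μ v := by
  simp only [fourthMoment, real_inner_smul_left, mul_pow, integral_const_mul]

lemma fourthMoment_eq_of_norm_eq {μ : Measure S2}
    (hinv : ∀ f : E3 ≃ₗᵢ[ℝ] E3, μ.map (sphereMap f) = μ) {v w : E3} (h : ‖v‖ = ‖w‖) :
    fourthMoment μ v = fourthMoment μ w := by
  set f := (Submodule.span ℝ {v - w})ᗮ.reflection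
  have hf : f v = w := Submodule.reflection_sub h
  have hc : Continuous (sphereMap f) := by
    unfold sphereMap
    fun_prop
  have hi := integral_map hc.aemeasurable
    (μ := μ) (continuous_inner_pow w).aestronglyMeasurable
  rw [hinv f] at hi
  rw [fourthMoment, fourthMoment, hi]
  congr 1 with x
  rw [← hf]
  simp [sphereMap]

lemma fourthMoment_single_zero {μ : Measure S2} [IsProbabilityMeasure μ]
    (hinv : ∀ f : E3 ≃ₗᵢ[ℝ] E3, μ.map (sphereMap f) = μ) :
    fourthMoment μ (EuclideanSpace.single 0 1) = 1 / 5 := by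
  set e : Fin 3 → E3 := fun i => EuclideanSpace.single i 1 with he
  set C := fourthMoment μ (e 0)
  have hsingle (i : Fin 3) : fourthMoment μ (e i) = C :=
    fourthMoment_eq_of_norm_eq hinv (by simp [he])
  have hdiag (v : E3) (hv : ‖v‖ ^ 2 = 2) : fourthMoment μ v = 4 * C := by
    have hn : ‖v‖ = ‖√2 • e 0‖ := by
      rw [← Real.sqrt_sq (norm_nonneg v), hv]
      simp [he, norm_smul, abs_of_nonneg (Real.sqrt_nonneg 2)]
    rw [fourthMoment_eq_of_norm_eq hinv hn, fourthMoment_smul]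
    have : √2 ^ 4 = 4 := by
      rw [show 4 = 2 * 2 from rfl, pow_mul, Real.sq_sqrt (by norm_num)]
      norm_num
    rw [this]
  have hadd (i j : Fin 3) (hij : i ≠ j) : fourthMoment μ (e i + e j) = 4 * C := by
    refine hdiag _ ?_
    rw [norm_add_sq_real]
    simp [he, EuclideanSpace.inner_single_left, hij]
    norm_num
  have hsub (i j : Fin 3) (hij : i ≠ j) : fourthMoment μ (e i - e j) = 4 * C := by
    refine hdiag _ ?_
    rw [norm_sub_sq_real]
    simp [he, EuclideanSpace.inner_single_left, hij]
    norm_num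
  have hpt (x : S2) : 2 * (inner ℝ (e 0) (x : E3) : ℝ) ^ 4
      + 2 * (inner ℝ (e 1) (x : E3) : ℝ) ^ 4 + 2 * (inner ℝ (e 2) (x : E3) : ℝ) ^ 4
      + (inner ℝ (e 0 + e 1) (x : E3) : ℝ) ^ 4 + (inner ℝ (e 0 - e 1) (x : E3) : ℝ) ^ 4
      + (inner ℝ (e 0 + e 2) (x : E3) : ℝ) ^ 4 + (inner ℝ (e 0 - e 2) (x : E3) : ℝ) ^ 4
      + (inner ℝ (e 1 + e 2) (x : E3) : ℝ) ^ 4 + (inner ℝ (e 1 - e 2) (x : E3) : ℝ) ^ 4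
      = 6 := by
    have hx : ‖(x : E3)‖ ^ 2 = 1 := by simp
    rw [EuclideanSpace.real_norm_sq_eq, Fin.sum_univ_three] at hx
    simp only [he, inner_add_left, inner_sub_left, EuclideanSpace.inner_single_left, map_one,
      one_mul]
    linear_combination 6 * ((x : E3) 0 ^ 2 + (x : E3) 1 ^ 2 + (x : E3) 2 ^ 2 + 1) * hx
  have hsum := integral_congr_ae (μ := μ) (.of_forall hpt)
  rw [integral_add, integral_add, integral_add, integral_add, integral_add, integral_add,
    integral_add, integral_add, integral_const_mul, integral_const_mul, integral_const_mul,
    integral_const, probReal_univ] at hsum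
  · have hfold (v : E3) : ∫ x : S2, (inner ℝ v (x : E3) : ℝ) ^ 4 ∂μ = fourthMoment μ v := rfl
    simp only [hfold, hsingle, hadd 0 1 (by decide), hadd 0 2 (by decide),
      hadd 1 2 (by decide), hsub 0 1 (by decide), hsub 0 2 (by decide),
      hsub 1 2 (by decide), smul_eq_mul] at hsum
    linarith
  all_goals
    exact Continuous.integrable_of_hasCompactSupport (by fun_prop) (.of_compactSpace _)

lemma fourthMoment_eq {μ : Measure S2} [IsProbabilityMeasure μ]
    (hinv : ∀ f : E3 ≃ₗᵢ[ℝ] E3, μ.map (sphereMap f) = μ) (v : E3) :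
    fourthMoment μ v = ‖v‖ ^ 4 / 5 := by
  have hn : ‖v‖ = ‖‖v‖ • (EuclideanSpace.single 0 1 : E3)‖ := by simp [norm_smul]
  rw [fourthMoment_eq_of_norm_eq hinv hn, fourthMoment_smul, fourthMoment_single_zero hinv]
  ring

/-- for every separable two-qubit density matrix `ρ`, the fourth moment of
random correlations satisfies
`R^(4)(ρ) = ∬_{S²×S²} (Tr[ρ (σ_u ⊗ σ_w)])⁴ dμ(u)dμ(w) ≤ 1/25`,
where `μ` is the rotation-invariant (uniform) probability measure on `S²`. -/
theorem fourth_moment_le_of_separable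
    (ρ : Matrix (Fin 2 × Fin 2) (Fin 2 × Fin 2) ℂ) (hsep : IsSeparableTwoQubit ρ)
    (μ : Measure S2) [IsProbabilityMeasure μ]
    (hinv : ∀ f : E3 ≃ₗᵢ[ℝ] E3, μ.map (sphereMap f) = μ) :
    (∫ p : S2 × S2,
        ((ρ * (pauliVec (coords p.1) ⊗ₖ pauliVec (coords p.2))).trace).re ^ 4
        ∂(μ.prod μ)) ≤ 1 / 25 := by
  obtain ⟨n, p, A, B, hp, hp1, hA, hAt, hB, hBt, rfl⟩ := hsep
  choose a ha ha' using fun k => exists_bloch_vector (hA k) (hAt k)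
  choose b hb hb' using fun k => exists_bloch_vector (hB k) (hBt k)
  have htrace (x : S2 × S2) :
      (((∑ k, (p k : ℂ) • (A k ⊗ₖ B k)) *
        (pauliVec (coords x.1) ⊗ₖ pauliVec (coords x.2))).trace).re =
      ∑ k, p k * (inner ℝ (a k) (x.1 : E3) * inner ℝ (b k) (x.2 : E3)) := by
    simp only [Finset.sum_mul, Matrix.trace_sum, Matrix.smul_mul, Matrix.trace_smul,
      ← Matrix.mul_kronecker_mul, Matrix.trace_kronecker, ha', hb', smul_eq_mul]
    rw [← Complex.ofReal_re (∑ k, p k * _)]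
    push_cast
    rfl
  simp only [htrace]
  have hprod (k : Fin n) : Integrable (fun x : S2 × S2 =>
      (inner ℝ (a k) (x.1 : E3) : ℝ) ^ 4 * (inner ℝ (b k) (x.2 : E3) : ℝ) ^ 4) (μ.prod μ) :=
    (integrable_inner_pow μ (a k)).mul_prod (integrable_inner_pow μ (b k))
  have hle (v : E3) (hv : ‖v‖ ≤ 1) : fourthMoment μ v ≤ 1 / 5 := by
    rw [fourthMoment_eq hinv]
    gcongr
    exact pow_le_one₀ (norm_nonneg v) hv
  have hnonneg (v : E3) : 0 ≤ fourthMoment μ v := by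
    rw [fourthMoment_eq hinv]
    positivity
  calc
    _ ≤ ∫ x : S2 × S2, ∑ k, p k *
        ((inner ℝ (a k) (x.1 : E3) : ℝ) ^ 4 * (inner ℝ (b k) (x.2 : E3) : ℝ) ^ 4)
        ∂(μ.prod μ) := by
      refine integral_mono_of_nonneg (.of_forall fun x => Even.pow_nonneg (by decide) _)
        (integrable_finsetSum _ fun k _ => (hprod k).const_mul _) (.of_forall fun x => ?_)
      simp only [← mul_pow]
      exact Real.pow_arith_mean_le_arith_mean_pow_of_even _ _ _ (fun k _ => hp k) hp1 (by decide)
    _ = ∑ k, p k * (fourthMoment μ (a k) * fourthMoment μ (b k)) := by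
      rw [integral_finsetSum _ fun k _ => (hprod k).const_mul _]
      refine Finset.sum_congr rfl fun k _ => ?_
      rw [integral_const_mul, integral_prod_mul
        (fun x : S2 => (inner ℝ (a k) (x : E3) : ℝ) ^ 4)
        (fun x : S2 => (inner ℝ (b k) (x : E3) : ℝ) ^ 4)]
      rfl
    _ ≤ ∑ k, p k * (1 / 5 * (1 / 5)) := by
      gcongr with k
      · exact hp k
      · exact hnonneg _
      · exact hle _ (ha k)
      · exact hle _ (hb k)
    _ = 1 / 25 := by
      rw [← Finset.sum_mul, hp1]
      norm_num
end
end

section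
/- Let c₁, c₂, c₃ be real parameters such that ρ_BD(c₁,c₂,c₃) is positive semidefinite (so that it is a two-qubit density matrix). Then ρ_BD is separable if and only if |c₁| + |c₂| + |c₃| ≤ 1. -/
open Matrix Kronecker
open scoped ComplexOrder

noncomputable section

/-- The Bell-diagonal matrix `ρ_BD = (1/4)(I₄ + Σ_j c_j σ_j ⊗ σ_j)`. -/
def rhoBD (c₁ c₂ c₃ : ℝ) : Matrix (Fin 2 × Fin 2) (Fin 2 × Fin 2) ℂ :=
  (1 / 4 : ℂ) • (1 + (c₁ : ℂ) • (pauli 0 ⊗ₖ pauli 0) + (c₂ : ℂ) • (pauli 1 ⊗ₖ pauli 1)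
    + (c₃ : ℂ) • (pauli 2 ⊗ₖ pauli 2))

theorem pauli_mul_self (j : Fin 3) : pauli j * pauli j = 1 := by
  fin_cases j <;> ext a b <;> fin_cases a <;> fin_cases b <;> simp [pauli]

theorem isHermitian_pauli (j : Fin 3) : (pauli j).IsHermitian := by
  fin_cases j <;> ext a b <;> fin_cases a <;> fin_cases b <;> simp [pauli]

theorem trace_pauli (j : Fin 3) : (pauli j).trace = 0 := by
  fin_cases j <;> simp [pauli, Matrix.trace_fin_two]

theorem trace_pauli_mul_pauli (i j : Fin 3) :
    (pauli i * pauli j).trace = if i = j then 2 else 0 := by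
  fin_cases i <;> fin_cases j <;> simp [pauli, Matrix.trace_fin_two] <;> norm_num

theorem rhoBD_eq_sum (c : Fin 3 → ℝ) :
    rhoBD (c 0) (c 1) (c 2) = (1 / 4 : ℂ) • (1 + ∑ j, (c j : ℂ) • (pauli j ⊗ₖ pauli j)) := by
  simp [rhoBD, Fin.sum_univ_three, add_assoc]

theorem trace_rhoBD_mul (c : Fin 3 → ℝ) (j : Fin 3) :
    (rhoBD (c 0) (c 1) (c 2) * (pauli j ⊗ₖ pauli j)).trace = c j := by
  simp only [rhoBD_eq_sum, smul_mul_assoc, add_mul, one_mul, Finset.sum_mul, trace_smul, trace_add,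
    trace_sum, ← mul_kronecker_mul, trace_kronecker, trace_pauli, trace_pauli_mul_pauli]
  simp
  ring

/-- The `j`-th coordinate of the Bloch vector of `A`. -/
def blochCoord (A : Matrix (Fin 2) (Fin 2) ℂ) (j : Fin 3) : ℝ := (A * pauli j).trace.re

theorem Matrix.IsHermitian.trace_mul_pauli {A : Matrix (Fin 2) (Fin 2) ℂ} (hA : A.IsHermitian)
    (j : Fin 3) : (A * pauli j).trace = blochCoord A j := by
  refine (Complex.conj_eq_iff_re.mp ?_).symm
  rw [starRingEnd_apply, ← trace_conjTranspose, conjTranspose_mul, hA.eq,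
    (isHermitian_pauli j).eq, trace_mul_comm]

/-- The Bloch vector of a qubit density matrix lies in the unit ball. -/
theorem sum_sq_blochCoord_le_one {A : Matrix (Fin 2) (Fin 2) ℂ} (hA : A.PosSemidef)
    (htr : A.trace = 1) : ∑ j, blochCoord A j ^ 2 ≤ 1 := by
  have hdet := (Complex.le_def.mp hA.det_nonneg).1
  have h00 := congrArg Complex.im (hA.1.apply 0 0)
  have h11 := congrArg Complex.im (hA.1.apply 1 1)
  have hre := congrArg Complex.re (hA.1.apply 0 1)
  have him := congrArg Complex.im (hA.1.apply 0 1)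
  have ht := congrArg Complex.re htr
  simp [Matrix.det_fin_two, Matrix.trace_fin_two] at hdet h00 h11 hre him ht
  have hi0 : (A 0 0).im = 0 := by linarith
  have hi1 : (A 1 1).im = 0 := by linarith
  have hb : (A 1 1).re = 1 - (A 0 0).re := by linarith
  simp [blochCoord, pauli, Fin.sum_univ_three, Matrix.trace_fin_two, Matrix.mul_apply]
  rw [hre, hb, ← him]
  rw [hre, ← him, hi0, hi1, hb] at hdet
  nlinarith

theorem sum_abs_mul_le_one {ι : Type*} [Fintype ι] {a b : ι → ℝ} (ha : ∑ j, a j ^ 2 ≤ 1)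
    (hb : ∑ j, b j ^ 2 ≤ 1) : ∑ j, |a j * b j| ≤ 1 := by
  have h : ∑ j, |a j * b j| ≤ ∑ j, (a j ^ 2 + b j ^ 2) / 2 := by
    refine Finset.sum_le_sum fun j _ => ?_
    rw [abs_mul]
    nlinarith [sq_nonneg (|a j| - |b j|), sq_abs (a j), sq_abs (b j)]
  rw [← Finset.sum_div, Finset.sum_add_distrib] at h
  linarith

theorem sum_abs_le_one_of_isSeparable {c : Fin 3 → ℝ}
    (h : IsSeparableTwoQubit (rhoBD (c 0) (c 1) (c 2))) : ∑ j, |c j| ≤ 1 := by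
  obtain ⟨n, p, A, B, hp, hp1, hA, hA1, hB, hB1, hρ⟩ := h
  have hc (j : Fin 3) : c j = ∑ k, p k * (blochCoord (A k) j * blochCoord (B k) j) := by
    have := trace_rhoBD_mul c j
    simp only [hρ, Finset.sum_mul, smul_mul_assoc, trace_sum, trace_smul, ← mul_kronecker_mul,
      trace_kronecker, (hA _).1.trace_mul_pauli, (hB _).1.trace_mul_pauli, smul_eq_mul] at this
    exact_mod_cast this.symm
  calc ∑ j, |c j| ≤ ∑ j, ∑ k, p k * |blochCoord (A k) j * blochCoord (B k) j| := by
        refine Finset.sum_le_sum fun j _ => ?_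
        rw [hc j]
        refine (Finset.abs_sum_le_sum_abs _ _).trans_eq (Finset.sum_congr rfl fun k _ => ?_)
        rw [abs_mul, abs_of_nonneg (hp k)]
    _ = ∑ k, p k * ∑ j, |blochCoord (A k) j * blochCoord (B k) j| := by
        rw [Finset.sum_comm]
        simp only [Finset.mul_sum]
    _ ≤ ∑ k, p k := Finset.sum_le_sum fun k _ => mul_le_of_le_one_right (hp k)
        (sum_abs_mul_le_one (sum_sq_blochCoord_le_one (hA k) (hA1 k))
          (sum_sq_blochCoord_le_one (hB k) (hB1 k)))
    _ = 1 := hp1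

theorem isSeparableTwoQubit_of_fintype {ι : Type*} [Fintype ι] (p : ι → ℝ)
    (A B : ι → Matrix (Fin 2) (Fin 2) ℂ) (hp : ∀ k, 0 ≤ p k) (hp1 : ∑ k, p k = 1)
    (hA : ∀ k, (A k).PosSemidef) (hA1 : ∀ k, (A k).trace = 1)
    (hB : ∀ k, (B k).PosSemidef) (hB1 : ∀ k, (B k).trace = 1) :
    IsSeparableTwoQubit (∑ k, (p k : ℂ) • (A k ⊗ₖ B k)) := by
  let e := (Fintype.equivFin ι).symm
  refine ⟨Fintype.card ι, p ∘ e, A ∘ e, B ∘ e, fun k => hp _, ?_, fun k => hA _, fun k => hA1 _,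
    fun k => hB _, fun k => hB1 _, ?_⟩
  · exact (e.sum_comp p).trans hp1
  · exact (e.sum_comp fun k => (p k : ℂ) • (A k ⊗ₖ B k)).symm

/-- The spectral projection `(1 + s σ_j) / 2` of a Pauli matrix, for a sign `s`. -/
def pauliProj (s : ℤˣ) (j : Fin 3) : Matrix (Fin 2) (Fin 2) ℂ :=
  (1 / 2 : ℂ) • (1 + ((s : ℤ) : ℂ) • pauli j)

theorem posSemidef_pauliProj (s : ℤˣ) (j : Fin 3) : (pauliProj s j).PosSemidef := by
  have hH : (pauliProj s j)ᴴ = pauliProj s j := by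
    simp [pauliProj, (isHermitian_pauli j).eq]
  have hs : ((s : ℤ) : ℂ) * ((s : ℤ) : ℂ) = 1 := by
    rcases Int.units_eq_one_or s with rfl | rfl <;> simp
  have hsq : pauliProj s j * pauliProj s j = pauliProj s j := by
    simp only [pauliProj, smul_mul_smul_comm, add_mul, mul_add, one_mul, mul_one, pauli_mul_self,
      hs]
    module
  have := posSemidef_conjTranspose_mul_self (pauliProj s j)
  rwa [hH, hsq] at this

theorem trace_pauliProj (s : ℤˣ) (j : Fin 3) : (pauliProj s j).trace = 1 := by
  simp [pauliProj, trace_pauli]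

theorem sum_pauliProj_kronecker (r : ℤˣ) (j : Fin 3) :
    ∑ s : ℤˣ, pauliProj s j ⊗ₖ pauliProj (s * r) j =
      (1 / 2 : ℂ) • (1 + ((r : ℤ) : ℂ) • (pauli j ⊗ₖ pauli j)) := by
  rw [← one_kronecker_one, show (Finset.univ : Finset ℤˣ) = {1, -1} from rfl,
    Finset.sum_pair (by decide)]
  simp only [pauliProj, smul_kronecker, kronecker_smul, add_kronecker, kronecker_add]
  push_cast
  module

theorem exists_units_mul_abs (x : ℝ) : ∃ r : ℤˣ, |x| * ((r : ℤ) : ℝ) = x := by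
  rcases abs_choice x with h | h
  · exact ⟨1, by simp [h]⟩
  · exact ⟨-1, by simp [h]⟩

theorem isSeparable_of_sum_abs_le_one {c : Fin 3 → ℝ} (h : ∑ j, |c j| ≤ 1) :
    IsSeparableTwoQubit (rhoBD (c 0) (c 1) (c 2)) := by
  choose r hr using fun j => exists_units_mul_abs (c j)
  have hmixed : ((1 / 2 : ℂ) • (1 : Matrix (Fin 2) (Fin 2) ℂ)).PosSemidef :=
    PosSemidef.one.smul (by norm_num [Complex.le_def])
  have hmixed1 : ((1 / 2 : ℂ) • (1 : Matrix (Fin 2) (Fin 2) ℂ)).trace = 1 := by simp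
  have key := isSeparableTwoQubit_of_fintype (ι := Option (Fin 3 × ℤˣ))
    (fun k => k.elim (1 - ∑ j, |c j|) fun q => |c q.1| / 2)
    (fun k => k.elim ((1 / 2 : ℂ) • 1) fun q => pauliProj q.2 q.1)
    (fun k => k.elim ((1 / 2 : ℂ) • 1) fun q => pauliProj (q.2 * r q.1) q.1)
    (by rintro (_ | q)
        · simpa using h
        · simp only [Option.elim]; positivity)
    (by simp [Fintype.sum_option, Fintype.sum_prod_type, mul_div_cancel₀])
    (by rintro (_ | q); exacts [hmixed, posSemidef_pauliProj _ _])
    (by rintro (_ | q); exacts [hmixed1, trace_pauliProj _ _])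
    (by rintro (_ | q); exacts [hmixed, posSemidef_pauliProj _ _])
    (by rintro (_ | q); exacts [hmixed1, trace_pauliProj _ _])
  convert key using 1
  have hr' (j : Fin 3) : (c j : ℂ) = (|c j| : ℝ) * ((r j : ℤ) : ℂ) := by
    exact_mod_cast congrArg Complex.ofReal (hr j).symm
  simp only [Fintype.sum_option, Fintype.sum_prod_type, Option.elim, ← Finset.smul_sum,
    sum_pauliProj_kronecker, rhoBD_eq_sum, hr', smul_kronecker, kronecker_smul, one_kronecker_one,
    Fin.sum_univ_three]
  push_cast
  module

/-- if the Bell-diagonal matrix `ρ_BD(c₁,c₂,c₃)` is positive semidefinite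
(hence a two-qubit density matrix), then it is separable if and only if
`|c₁| + |c₂| + |c₃| ≤ 1`. -/
theorem bellDiagonal_separable_iff (c₁ c₂ c₃ : ℝ) (hpsd : (rhoBD c₁ c₂ c₃).PosSemidef) :
    IsSeparableTwoQubit (rhoBD c₁ c₂ c₃) ↔ |c₁| + |c₂| + |c₃| ≤ 1 := by
  have hsum : ∑ j, |![c₁, c₂, c₃] j| = |c₁| + |c₂| + |c₃| := by simp [Fin.sum_univ_three]
  rw [← hsum]
  exact ⟨sum_abs_le_one_of_isSeparable (c := ![c₁, c₂, c₃]),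
    isSeparable_of_sum_abs_le_one (c := ![c₁, c₂, c₃])⟩
end
end

section
/- Let c₁, c₂, c₃ be real numbers with |c₁| + |c₂| + |c₃| ≤ 1, and set y = c₁² + c₂² + c₃². If 1/3 ≤ y ≤ 1/2, then c₁⁴ + c₂⁴ + c₃⁴ ≥ y²/2 + y/3 − (2√2/27)(3y − 1)^{3/2} − 7/54. (Equivalently, in terms of the Bell-diagonal moments R^(2) = y/9 and R^(4) = (2(c₁⁴+c₂⁴+c₃⁴)+y²)/75, every separable Bell-diagonal state with 1/27 ≤ R^(2) ≤ 1/18 satisfies R^(4) ≥ (9/225)(2R^(2) + 54(R^(2))² − (4√2/81)(27R^(2)−1)^{3/2} − 7/81).) -/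
/-- Lower bound on the fourth power sum of a nonnegative triple with sum at most `1` and sum of squares
`(1 + 2 * w ^ 2) / 3`. Equality holds at `((1 + w) / 3, (1 + w) / 3, (1 - 2 * w) / 3)`. -/
lemma sum_pow_four_ge_of_add_le_one {a b c w : ℝ} (ha : 0 ≤ a) (hb : 0 ≤ b) (hc : 0 ≤ c)
    (hw₀ : 0 ≤ w) (hw : w ≤ 1 / 2) (hs : a + b + c ≤ 1)
    (hq : a ^ 2 + b ^ 2 + c ^ 2 = (1 + 2 * w ^ 2) / 3) :
    2 * ((1 + w) / 3) ^ 4 + ((1 - 2 * w) / 3) ^ 4 ≤ a ^ 4 + b ^ 4 + c ^ 4 := by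
  rcases le_total c ((1 - 2 * w) / 3) with hcase | hcase
  · have hsq : c ^ 2 ≤ ((1 - 2 * w) / 3) ^ 2 := pow_le_pow_left₀ hc hcase 2
    have hle : ((1 - 2 * w) / 3) ^ 2 ≤ (1 + 2 * w ^ 2) / 9 := by nlinarith
    have hab : a ^ 2 + b ^ 2 = (1 + 2 * w ^ 2) / 3 - c ^ 2 := by linarith
    have hmean : (a ^ 2 + b ^ 2) ^ 2 / 2 ≤ a ^ 4 + b ^ 4 := by
      nlinarith [sq_nonneg (a ^ 2 - b ^ 2)]
    rw [hab] at hmean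
    nlinarith [mul_nonneg (sub_nonneg.2 hsq)
      (by linarith : 0 ≤ 2 * ((1 + 2 * w ^ 2) / 9) - c ^ 2 - ((1 - 2 * w) / 3) ^ 2)]
  · have hprod : 2 * (a * b) ≤ (1 - c) ^ 2 - (1 + 2 * w ^ 2) / 3 + c ^ 2 := by
      have := pow_le_pow_left₀ (add_nonneg ha hb) (by linarith : a + b ≤ 1 - c) 2
      nlinarith
    have hprod_sq := pow_le_pow_left₀ (by positivity) hprod 2
    have hab : a ^ 4 + b ^ 4 = ((1 + 2 * w ^ 2) / 3 - c ^ 2) ^ 2 - (2 * (a * b)) ^ 2 / 2 := by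
      rw [← hq]; ring
    have hfactor : 0 ≤ (c - (1 - 2 * w) / 3) * (c - (1 + w) / 3) ^ 2 :=
      mul_nonneg (sub_nonneg.2 hcase) (sq_nonneg _)
    nlinarith

/-- let `c₁, c₂, c₃` be real numbers with `|c₁| + |c₂| + |c₃| ≤ 1` and set
`y = c₁² + c₂² + c₃²`. If `1/3 ≤ y ≤ 1/2`, then
`c₁⁴ + c₂⁴ + c₃⁴ ≥ y²/2 + y/3 − (2√2/27)(3y − 1)^{3/2} − 7/54`.
(This is the lower boundary of the set of separable Bell-diagonal states in the
`(R^(2)`, `R^(4))` plane in the middle range.) -/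
theorem separable_lower_boundary_middle (c₁ c₂ c₃ y : ℝ)
    (hsep : |c₁| + |c₂| + |c₃| ≤ 1)
    (hy : y = c₁ ^ 2 + c₂ ^ 2 + c₃ ^ 2)
    (h₁ : 1 / 3 ≤ y) (h₂ : y ≤ 1 / 2) :
    c₁ ^ 4 + c₂ ^ 4 + c₃ ^ 4 ≥
      y ^ 2 / 2 + y / 3 - (2 * Real.sqrt 2 / 27) * (3 * y - 1) ^ ((3 : ℝ) / 2) - 7 / 54 := by
  have hw_sq : √((3 * y - 1) / 2) ^ 2 = (3 * y - 1) / 2 := Real.sq_sqrt (by linarith)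
  have hw₀ : 0 ≤ √((3 * y - 1) / 2) := Real.sqrt_nonneg _
  have hw : √((3 * y - 1) / 2) ≤ 1 / 2 := Real.sqrt_le_iff.2 ⟨by norm_num, by linarith⟩
  generalize √((3 * y - 1) / 2) = w at hw_sq hw₀ hw
  have hsqrt : √(3 * y - 1) = √2 * w := by
    rw [show 3 * y - 1 = 2 * w ^ 2 by linarith, Real.sqrt_mul zero_le_two, Real.sqrt_sq hw₀]
  have hpow : (3 * y - 1) ^ ((3 : ℝ) / 2) = 2 * √2 * w ^ 3 := by
    rw [show (3 : ℝ) / 2 = 1 + 1 / 2 by norm_num, Real.rpow_add_of_nonneg (by linarith)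
      zero_le_one (by norm_num), Real.rpow_one, ← Real.sqrt_eq_rpow, hsqrt,
      show 3 * y - 1 = 2 * w ^ 2 by linarith]
    ring
  have hmain := sum_pow_four_ge_of_add_le_one (abs_nonneg c₁) (abs_nonneg c₂) (abs_nonneg c₃)
    hw₀ hw hsep (by simp only [sq_abs]; linarith)
  simp only [Even.pow_abs (by decide : Even 4)] at hmain
  have hcoeff : 2 * √2 / 27 * (2 * √2 * w ^ 3) = 8 / 27 * w ^ 3 := by
    linear_combination 4 / 27 * w ^ 3 * Real.sq_sqrt (zero_le_two (α := ℝ))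
  rw [hpow, hcoeff, show y = (1 + 2 * w ^ 2) / 3 by linarith]
  linarith
end

section
/- Let c₁, c₂, c₃ be real numbers with |c₁| + |c₂| + |c₃| ≤ 1, and set y = c₁² + c₂² + c₃². If y ≥ 1/2, then c₁⁴ + c₂⁴ + c₃⁴ ≥ (y² + 2y − 1)/2. (Equivalently, in terms of the Bell-diagonal moments R^(2) = y/9 and R^(4) = (2(c₁⁴+c₂⁴+c₃⁴)+y²)/75, every separable Bell-diagonal state with R^(2) ≥ 1/18 satisfies R^(4) ≥ (9/225)(54(R^(2))² + 6R^(2) − 1/3).) -/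
/-- For nonnegative reals with sum at most `1`, `4 (a²b² + b²c² + c²a²)` is at most
`(1 - (a² + b² + c²))²`. -/
theorem four_mul_sum_sq_mul_sq_le {a b c : ℝ} (ha : 0 ≤ a) (hb : 0 ≤ b) (hc : 0 ≤ c)
    (h : a + b + c ≤ 1) :
    4 * (a ^ 2 * b ^ 2 + b ^ 2 * c ^ 2 + c ^ 2 * a ^ 2) ≤ (1 - (a ^ 2 + b ^ 2 + c ^ 2)) ^ 2 := by
  have hq : 0 ≤ 2 * (a * b + b * c + c * a) := by positivity
  have hle : 2 * (a * b + b * c + c * a) ≤ 1 - (a ^ 2 + b ^ 2 + c ^ 2) := by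
    nlinarith [add_nonneg (add_nonneg ha hb) hc]
  have hsq := pow_le_pow_left₀ hq hle 2
  have hp : 0 ≤ a * b * c * (a + b + c) := by positivity
  linarith

/-- let `c₁, c₂, c₃` be real numbers with `|c₁| + |c₂| + |c₃| ≤ 1` and set
`y = c₁² + c₂² + c₃²`. If `y ≥ 1/2`, then `c₁⁴ + c₂⁴ + c₃⁴ ≥ (y² + 2y − 1)/2`.
(This is the lower boundary of the set of separable Bell-diagonal states in the
`(R^(2)`, `R^(4))` plane in the upper range.) -/
theorem separable_lower_boundary_upper (c₁ c₂ c₃ y : ℝ)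
    (hsep : |c₁| + |c₂| + |c₃| ≤ 1)
    (hy : y = c₁ ^ 2 + c₂ ^ 2 + c₃ ^ 2)
    (h₁ : 1 / 2 ≤ y) :
    c₁ ^ 4 + c₂ ^ 4 + c₃ ^ 4 ≥ (y ^ 2 + 2 * y - 1) / 2 := by
  have key := four_mul_sum_sq_mul_sq_le (abs_nonneg c₁) (abs_nonneg c₂) (abs_nonneg c₃) hsep
  simp only [sq_abs] at key
  subst hy
  linarith
end

section
/- Let c₁, c₂, c₃ be real numbers such that the four eigenvalues λ₁ = (1−c₁−c₂−c₃)/4, λ₂ = (1+c₁+c₂−c₃)/4, λ₃ = (1+c₁−c₂+c₃)/4, λ₄ = (1−c₁+c₂+c₃)/4 of the Bell-diagonal matrix are all nonnegative, and set y = c₁² + c₂² + c₃². If y ≥ 1, then c₁⁴ + c₂⁴ + c₃⁴ ≤ (y² − 2y + 3)/2. (Equivalently, every Bell-diagonal two-qubit state with R^(2) ≥ 1/9 satisfies R^(4) ≤ (9/225)(1 − 6R^(2) + 54(R^(2))²), where R^(2) = y/9 and R^(4) = (2(c₁⁴+c₂⁴+c₃⁴)+y²)/75.) -/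
/-- Four times the product of four nonnegative reals with sum `1` is at most their third elementary
symmetric polynomial. -/
theorem four_mul_prod_le_esymm_three {a b c d : ℝ} (ha : 0 ≤ a) (hb : 0 ≤ b) (hc : 0 ≤ c)
    (hd : 0 ≤ d) (hsum : a + b + c + d = 1) :
    4 * (a * b * c * d) ≤ b * c * d + a * c * d + a * b * d + a * b * c := by
  have ha' : a * (b * c * d) ≤ b * c * d := mul_le_of_le_one_left (by positivity) (by linarith)
  have hb' : b * (a * c * d) ≤ a * c * d := mul_le_of_le_one_left (by positivity) (by linarith)
  have hc' : c * (a * b * d) ≤ a * b * d := mul_le_of_le_one_left (by positivity) (by linarith)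
  have hd' : d * (a * b * c) ≤ a * b * c := mul_le_of_le_one_left (by positivity) (by linarith)
  linarith

/-- let `c₁, c₂, c₃` be real numbers such that the four eigenvalues
`λ₁ = (1−c₁−c₂−c₃)/4`, `λ₂ = (1+c₁+c₂−c₃)/4`, `λ₃ = (1+c₁−c₂+c₃)/4`,
`λ₄ = (1−c₁+c₂+c₃)/4` of the Bell-diagonal matrix are all nonnegative, and set
`y = c₁² + c₂² + c₃²`. If `y ≥ 1`, then `c₁⁴ + c₂⁴ + c₃⁴ ≤ (y² − 2y + 3)/2`.
(This is the upper boundary of the set of all Bell-diagonal states in the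
`(R^(2)`, `R^(4))` plane in the upper range.) -/
theorem bellDiagonal_upper_boundary (c₁ c₂ c₃ y : ℝ)
    (hlam₁ : 0 ≤ (1 - c₁ - c₂ - c₃) / 4)
    (hlam₂ : 0 ≤ (1 + c₁ + c₂ - c₃) / 4)
    (hlam₃ : 0 ≤ (1 + c₁ - c₂ + c₃) / 4)
    (hlam₄ : 0 ≤ (1 - c₁ + c₂ + c₃) / 4)
    (hy : y = c₁ ^ 2 + c₂ ^ 2 + c₃ ^ 2)
    (h₁ : 1 ≤ y) :
    c₁ ^ 4 + c₂ ^ 4 + c₃ ^ 4 ≤ (y ^ 2 - 2 * y + 3) / 2 := by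
  have key := four_mul_prod_le_esymm_three hlam₁ hlam₂ hlam₃ hlam₄ (by ring)
  subst hy
  linarith
end
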